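/- arXiv:1409.0103 — 3 statements merged into one kernel-verified Lean document; each statement's English description precedes it below -/
import Mathlib

section
/- Let α > 0 and a > 0. Then the equation ψ_α(x, a) = 0 has exactly one solution x in the open interval (a, +∞). -/
/-- `ψ_α(x, a) = (3/4)(x−a)² + a(x−a) + 2α√a/√x − 2α − 2` -/
noncomputable def psiFun (α x a : ℝ) : ℝ :=
  (3 / 4) * (x - a) ^ 2 + a * (x - a) + 2 * α * Real.sqrt a / Real.sqrt x - 2 * α - 2

theorem inv_sqrt_chord {a x y : ℝ} (ha : 0 < a) (hax : a < x) (hxy : x < y) :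
    (y - a) * (√x)⁻¹ ≤ (y - x) * (√a)⁻¹ + (x - a) * (√y)⁻¹ := by
  have hs : 0 < √a := Real.sqrt_pos.2 ha
  have hsu : √a < √x := Real.sqrt_lt_sqrt ha.le hax
  have huv : √x < √y := Real.sqrt_lt_sqrt (ha.trans hax).le hxy
  have hu : 0 < √x := hs.trans hsu
  have hv : 0 < √y := hu.trans huv
  have ea : √a ^ 2 = a := Real.sq_sqrt ha.le
  have ex : √x ^ 2 = x := Real.sq_sqrt (ha.trans hax).le
  have ey : √y ^ 2 = y := Real.sq_sqrt ((ha.trans hax).trans hxy).le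
  have key : (y - x) * (√a)⁻¹ + (x - a) * (√y)⁻¹ - (y - a) * (√x)⁻¹ =
      (√y - √x) * (√x - √a) * (√y - √a) * (√a + √x + √y) / (√a * √x * √y) := by
    generalize √a = s at *
    generalize √x = u at *
    generalize √y = v at *
    subst ea ex ey
    field_simp
    ring
  have : 0 ≤ (√y - √x) * (√x - √a) * (√y - √a) * (√a + √x + √y) / (√a * √x * √y) := by
    have h1 := sub_pos.2 hsu
    have h2 := sub_pos.2 huv
    have h3 := sub_pos.2 (hsu.trans huv)
    positivity
  linarith

theorem not_psiFun_eq_zero_of_lt {α a x y : ℝ} (hα : 0 < α) (ha : 0 < a) (hax : a < x)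
    (hxy : x < y) (hx : psiFun α x a = 0) (hy : psiFun α y a = 0) : False := by
  have hs : 0 < √a := Real.sqrt_pos.2 ha
  have hc := mul_le_mul_of_nonneg_left (inv_sqrt_chord ha hax hxy)
    (by positivity : 0 ≤ 2 * α * √a)
  have hcancel : 2 * α * √a * ((y - x) * (√a)⁻¹) = 2 * α * (y - x) := by
    field_simp
  have hq : 0 < (x - a) * (y - a) * (y - x) :=
    mul_pos (mul_pos (sub_pos.2 hax) (sub_pos.2 (hax.trans hxy))) (sub_pos.2 hxy)
  unfold psiFun at hx hy
  rw [div_eq_mul_inv] at hx hy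
  refine lt_irrefl (0 : ℝ) ?_
  linear_combination (-(y - a)) * hx + (x - a) * hy + hc + hcancel + (3 / 4) * hq + 2 * hxy

theorem psiFun_self {a : ℝ} (α : ℝ) (ha : 0 < a) : psiFun α a a = -2 := by
  have hs : √a ≠ 0 := (Real.sqrt_pos.2 ha).ne'
  unfold psiFun
  field_simp
  ring

theorem continuousOn_psiFun (α a : ℝ) : ContinuousOn (fun x ↦ psiFun α x a) (Set.Ioi 0) := by
  unfold psiFun
  have : ∀ x ∈ Set.Ioi (0 : ℝ), √x ≠ 0 := fun x hx ↦ (Real.sqrt_pos.2 hx).ne'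
  fun_prop (disch := assumption)

/-- For `α > 0` and `a > 0`, the equation `ψ_α(x, a) = 0` has exactly one solution
`x` in `(a, +∞)`. -/
theorem existsUnique_psi_root (α a : ℝ) (hα : 0 < α) (ha : 0 < a) :
    ∃! x : ℝ, a < x ∧ psiFun α x a = 0 := by
  have hpos : 0 ≤ psiFun α (a + (2 + 2 * α)) a := by
    have h : 0 ≤ 2 * α * √a / √(a + (2 + 2 * α)) := by positivity
    unfold psiFun
    nlinarith [mul_pos ha hα]
  obtain ⟨x, hx, hx0⟩ := intermediate_value_Icc (by linarith : a ≤ a + (2 + 2 * α))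
    ((continuousOn_psiFun α a).mono fun z hz ↦ ha.trans_le hz.1)
    ⟨by simp [psiFun_self α ha], hpos⟩
  have hx0 : psiFun α x a = 0 := hx0
  have hax : a < x := by
    refine lt_of_le_of_ne hx.1 ?_
    rintro rfl
    norm_num [psiFun_self α ha] at hx0
  refine ⟨x, ⟨hax, hx0⟩, fun y ⟨hay, hy0⟩ ↦ ?_⟩
  rcases lt_trichotomy y x with h | h | h
  · exact (not_psiFun_eq_zero_of_lt hα ha hay h hy0 hx0).elim
  · exact h
  · exact (not_psiFun_eq_zero_of_lt hα ha hax h hx0 hy0).elim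
end

section
/- Let α ≥ 0 and 0 < a < b. The function f_{α,a,b} is nonnegative on (a, b] and satisfies ∫_a^b f_{α,a,b}(x) dx = 1 (i.e. f_{α,a,b} is a probability density on (a, b]) if and only if ψ_α(b, a) = 0 and φ_α(b, a) ≥ 0. -/
/-- `φ_α(x, a) = x + a − 2α/√(ax)` -/
noncomputable def phiFun (α x a : ℝ) : ℝ := x + a - 2 * α / Real.sqrt (a * x)

/-- `f_{α,a,b}(x) = (1/(2π))·√((b−x)/(x−a))·(2x + b − a − 2α√(a/b)/x)` -/
noncomputable def densF (α a b x : ℝ) : ℝ :=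
  (1 / (2 * Real.pi)) * Real.sqrt ((b - x) / (x - a)) *
    (2 * x + b - a - 2 * α * Real.sqrt (a / b) / x)

lemma sqrt_div_div_eq_inv_sqrt_mul {a b : ℝ} (ha : 0 < a) :
    Real.sqrt (a / b) / a = 1 / Real.sqrt (a * b) := by
  have h : a / b = a ^ 2 / (a * b) := by field_simp
  rw [h, Real.sqrt_div (sq_nonneg a), Real.sqrt_sq ha.le]
  field_simp

/-- The non-radical factor of the density, evaluated at the left endpoint, is `phiFun`. -/
lemma phiFun_eq_factor_left {α a b : ℝ} (ha : 0 < a) :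
    phiFun α b a = 2 * a + b - a - 2 * α * Real.sqrt (a / b) / a := by
  rw [mul_div_assoc, sqrt_div_div_eq_inv_sqrt_mul ha, phiFun]
  ring

lemma phiFun_nonneg_of_densF_nonneg {α a b : ℝ} (ha : 0 < a) (hab : a < b)
    (h : ∀ x ∈ Set.Ioc a b, 0 ≤ densF α a b x) : 0 ≤ phiFun α b a := by
  have hc : ContinuousAt
      (fun x : ℝ => 2 * x + b - a - 2 * α * Real.sqrt (a / b) / x) a := by
    fun_prop (disch := exact ha.ne')
  rw [phiFun_eq_factor_left ha]
  refine ge_of_tendsto (hc.tendsto.mono_left (nhdsWithin_le_nhds (s := Set.Ioi a))) ?_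
  filter_upwards [Ioo_mem_nhdsGT hab] with x hx
  have hx' := h x ⟨hx.1, hx.2.le⟩
  have hpos : 0 < (1 / (2 * Real.pi)) * Real.sqrt ((b - x) / (x - a)) := by
    have := div_pos (sub_pos.2 hx.2) (sub_pos.2 hx.1)
    positivity
  exact nonneg_of_mul_nonneg_right hx' hpos

lemma densF_nonneg_of_phiFun_nonneg {α a b x : ℝ} (hα : 0 ≤ α) (ha : 0 < a)
    (h : 0 ≤ phiFun α b a) (hx : a ≤ x) : 0 ≤ densF α a b x := by
  rw [phiFun_eq_factor_left ha] at h
  have hdiv : 2 * α * Real.sqrt (a / b) / x ≤ 2 * α * Real.sqrt (a / b) / a := by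
    gcongr
  unfold densF
  refine mul_nonneg (by positivity) (by linarith)

/-- An antiderivative of `2 * π * densF α a b` on `(a, b)`. -/
noncomputable def densFPrimitive (α a b x : ℝ) : ℝ :=
  (x + (a + b) / 2) * Real.sqrt ((b - x) * (x - a)) +
    (b ^ 2 - (a + b) ^ 2 / 4 + 2 * α * Real.sqrt (a / b)) *
      Real.arcsin ((2 * x - a - b) / (b - a)) -
    2 * α * Real.arcsin ((a + b - 2 * (a * b) / x) / (b - a))

/-- The derivative of `arcsin` composed with a function, when `1 - g ^ 2` is a known square. -/
lemma HasDerivAt.arcsin_of_one_sub_sq_eq {g : ℝ → ℝ} {g' r x : ℝ} (hg : HasDerivAt g g' x)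
    (hr : 0 < r) (h : 1 - g x ^ 2 = r ^ 2) :
    HasDerivAt (fun y => Real.arcsin (g y)) (g' / r) x := by
  have h1 : g x ≠ -1 := by
    intro h1
    rw [h1] at h
    nlinarith
  have h2 : g x ≠ 1 := by
    intro h2
    rw [h2] at h
    nlinarith
  have := (Real.hasDerivAt_arcsin h1 h2).comp x hg
  rw [h, Real.sqrt_sq hr.le, one_div_mul_eq_div] at this
  exact this

lemma hasDerivAt_densFPrimitive {α a b x : ℝ} (ha : 0 < a) (hx : x ∈ Set.Ioo a b) :
    HasDerivAt (densFPrimitive α a b) (2 * Real.pi * densF α a b x) x := by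
  obtain ⟨hax, hxb⟩ := hx
  have hx0 : 0 < x := ha.trans hax
  have hb : 0 < b := hx0.trans hxb
  have hd : 0 < b - a := by linarith
  have hbx : 0 < b - x := by linarith
  have hxa : 0 < x - a := by linarith
  have hq : 0 < (b - x) * (x - a) := mul_pos hbx hxa
  set s := Real.sqrt ((b - x) * (x - a)) with hs
  have hs0 : 0 < s := Real.sqrt_pos.2 hq
  have hs2 : s ^ 2 = (b - x) * (x - a) := Real.sq_sqrt hq.le
  set t := Real.sqrt (a / b) with ht
  have ht0 : 0 < t := Real.sqrt_pos.2 (div_pos ha hb)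
  have ht2 : t ^ 2 = a / b := Real.sq_sqrt (div_pos ha hb).le
  have hat : a = b * t ^ 2 := by rw [ht2]; field_simp
  have hquot : Real.sqrt ((b - x) / (x - a)) = (b - x) / s := by
    have : (b - x) / (x - a) = (b - x) ^ 2 / ((b - x) * (x - a)) := by field_simp
    rw [this, Real.sqrt_div (sq_nonneg _), Real.sqrt_sq hbx.le]
  have h1 : HasDerivAt (fun y => Real.sqrt ((b - y) * (y - a))) ((a + b - 2 * x) / (2 * s)) x := by
    have := (((hasDerivAt_id x).const_sub b).mul ((hasDerivAt_id x).sub_const a)).sqrt hq.ne'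
    refine this.congr_deriv ?_
    simp only [id, hs, Pi.mul_apply]
    ring
  have h2 : HasDerivAt (fun y => Real.arcsin ((2 * y - a - b) / (b - a))) (1 / s) x := by
    have hg : HasDerivAt (fun y => (2 * y - a - b) / (b - a)) (2 / (b - a)) x := by
      have := ((((hasDerivAt_id x).const_mul 2).sub_const a).sub_const b).div_const (b - a)
      simpa using this
    refine (hg.arcsin_of_one_sub_sq_eq (r := 2 * s / (b - a)) (by positivity) ?_).congr_deriv ?_
    · rw [div_pow, div_pow, mul_pow, hs2]
      field_simp
      ring
    · field_simp
  have h3 : HasDerivAt (fun y => Real.arcsin ((a + b - 2 * (a * b) / y) / (b - a)))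
      (b * t / (x * s)) x := by
    have hg : HasDerivAt (fun y => (a + b - 2 * (a * b) / y) / (b - a))
        (2 * (a * b) / x ^ 2 / (b - a)) x := by
      have := (((hasDerivAt_inv hx0.ne').const_mul (2 * (a * b))).const_sub (a + b)).div_const
        (b - a)
      simpa [div_eq_mul_inv] using this
    refine (hg.arcsin_of_one_sub_sq_eq (r := 2 * (b * t) * s / ((b - a) * x))
      (by positivity) ?_).congr_deriv ?_
    · have : (2 * (b * t) * s) ^ 2 = 4 * (a * b) * ((b - x) * (x - a)) := by
        rw [mul_pow, hs2, hat]; ring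
      rw [div_pow, div_pow, this]
      field_simp
      ring
    · have : a * b = (b * t) ^ 2 := by rw [hat]; ring
      rw [this]
      field_simp
  have h4 : HasDerivAt (fun y : ℝ => y + (a + b) / 2) 1 x := (hasDerivAt_id x).add_const _
  refine (((h4.mul h1).add (h2.const_mul (b ^ 2 - (a + b) ^ 2 / 4 + 2 * α * t))).sub
    (h3.const_mul (2 * α))).congr_deriv ?_
  rw [densF, hquot, ← hs, ← ht]
  field_simp
  rw [hs2]
  ring

lemma continuousOn_densFPrimitive {α a b : ℝ} (ha : 0 < a) :
    ContinuousOn (densFPrimitive α a b) (Set.Icc a b) := by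
  have hinv : ContinuousOn (fun x : ℝ => 2 * (a * b) / x) (Set.Icc a b) :=
    continuousOn_const.div continuousOn_id fun x hx => (ha.trans_le hx.1).ne'
  have harc : ContinuousOn (fun x : ℝ => Real.arcsin ((a + b - 2 * (a * b) / x) / (b - a)))
      (Set.Icc a b) :=
    Real.continuous_arcsin.comp_continuousOn ((continuousOn_const.sub hinv).div_const _)
  refine ContinuousOn.sub (Continuous.continuousOn ?_) (continuousOn_const.mul harc)
  have := Real.continuous_arcsin
  fun_prop

lemma densFPrimitive_sub {α a b : ℝ} (ha : 0 < a) (hab : a < b) :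
    densFPrimitive α a b b - densFPrimitive α a b a = Real.pi * (psiFun α b a + 2) := by
  have hb : 0 < b := ha.trans hab
  have hd : b - a ≠ 0 := by linarith
  have e1 : (2 * b - a - b) / (b - a) = 1 := by field_simp; ring
  have e2 : (2 * a - a - b) / (b - a) = -1 := by field_simp; ring
  have e3 : (a + b - 2 * (a * b) / b) / (b - a) = 1 := by field_simp; ring
  have e4 : (a + b - 2 * (a * b) / a) / (b - a) = -1 := by field_simp; ring
  unfold densFPrimitive psiFun
  rw [e1, e2, e3, e4, Real.arcsin_neg, Real.arcsin_one, Real.sqrt_div ha.le]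
  simp only [sub_self, zero_mul, mul_zero, Real.sqrt_zero]
  ring

lemma integral_densF {α a b : ℝ} (hα : 0 ≤ α) (ha : 0 < a) (hab : a < b)
    (h : 0 ≤ phiFun α b a) :
    ∫ x in Set.Ioo a b, densF α a b x = (psiFun α b a + 2) / 2 := by
  have hderiv : ∀ x ∈ Set.Ioo a b,
      HasDerivAt (densFPrimitive α a b) (2 * Real.pi * densF α a b x) x :=
    fun x hx => hasDerivAt_densFPrimitive ha hx
  have hcont := continuousOn_densFPrimitive (α := α) (b := b) ha
  have hint := intervalIntegral.integrableOn_deriv_of_nonneg hcont hderiv fun x hx =>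
    mul_nonneg (by positivity) (densF_nonneg_of_phiFun_nonneg hα ha h hx.1.le)
  have hFTC := intervalIntegral.integral_eq_sub_of_hasDerivAt_of_le hab.le hcont hderiv
    ((intervalIntegrable_iff_integrableOn_Ioc_of_le hab.le).2 hint)
  rw [intervalIntegral.integral_const_mul, densFPrimitive_sub ha hab,
    intervalIntegral.integral_of_le hab.le, MeasureTheory.integral_Ioc_eq_integral_Ioo] at hFTC
  have := Real.pi_pos
  have hc : Real.pi * (2 * ∫ x in Set.Ioo a b, densF α a b x) =
      Real.pi * (psiFun α b a + 2) := by linarith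
  linarith [mul_left_cancel₀ this.ne' hc]

/-- `f_{α,a,b}` is a probability density on `(a, b]` iff `ψ_α(b,a) = 0` and
`φ_α(b,a) ≥ 0`. -/
theorem densF_probability_iff (α a b : ℝ) (hα : 0 ≤ α) (ha : 0 < a) (hab : a < b) :
    ((∀ x ∈ Set.Ioc a b, 0 ≤ densF α a b x) ∧ ∫ x in Set.Ioo a b, densF α a b x = 1) ↔
      (psiFun α b a = 0 ∧ 0 ≤ phiFun α b a) := by
  constructor
  · rintro ⟨hnonneg, hone⟩
    have hφ := phiFun_nonneg_of_densF_nonneg ha hab hnonneg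
    rw [integral_densF hα ha hab hφ] at hone
    exact ⟨by linarith, hφ⟩
  · rintro ⟨hψ, hφ⟩
    refine ⟨fun x hx => densF_nonneg_of_phiFun_nonneg hα ha hφ hx.1.le, ?_⟩
    rw [integral_densF hα ha hab hφ, hψ]
    norm_num
end

section
/- For all 0 < a < b, ∫_a^b √((t−a)(b−t))·(1/t) dt = (π/2)·(√b − √a)². -/
theorem HasDerivAt.arcsin_of_sq_add_sq {u : ℝ → ℝ} {u' w x : ℝ} (hu : HasDerivAt u u' x)
    (hw : 0 < w) (h : u x ^ 2 + w ^ 2 = 1) :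
    HasDerivAt (fun t => Real.arcsin (u t)) (u' / w) x := by
  have hsqrt : Real.sqrt (1 - u x ^ 2) = w := by
    rw [← h, add_sub_cancel_left, Real.sqrt_sq hw.le]
  have h₁ : u x ≠ -1 := by
    intro h'
    rw [h'] at h
    nlinarith [pow_pos hw 2]
  have h₂ : u x ≠ 1 := by
    intro h'
    rw [h'] at h
    nlinarith [pow_pos hw 2]
  have key := (Real.hasDerivAt_arcsin h₁ h₂).comp x hu
  rw [hsqrt] at key
  exact key.congr_deriv (by ring)

/-- An antiderivative of `√((t - a)(b - t)) / t` on `(a, b)`. -/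
theorem hasDerivAt_sqrt_div_antideriv {a b x : ℝ} (ha : 0 < a) (hax : a < x) (hxb : x < b) :
    HasDerivAt (fun t => Real.sqrt ((t - a) * (b - t))
      + (a + b) / 2 * Real.arcsin ((2 * t - a - b) / (b - a))
      - Real.sqrt (a * b) * Real.arcsin (((a + b) * t - 2 * a * b) / (t * (b - a))))
      (Real.sqrt ((x - a) * (b - x)) / x) x := by
  have hx : 0 < x := ha.trans hax
  have hb : 0 < b := hx.trans hxb
  have hd : 0 < b - a := by linarith
  have hR : 0 < (x - a) * (b - x) := mul_pos (by linarith) (by linarith)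
  have hS := Real.sqrt_pos.2 hR
  have hS2 := Real.sq_sqrt hR.le
  have hg := Real.sqrt_pos.2 (mul_pos ha hb)
  have hg2 := Real.sq_sqrt (mul_pos ha hb).le
  have d₁ : HasDerivAt (fun t => Real.sqrt ((t - a) * (b - t))) _ x :=
    (((hasDerivAt_id' x).sub_const a).mul ((hasDerivAt_id' x).const_sub b)).sqrt hR.ne'
  have d₂ : HasDerivAt (fun t => (2 * t - a - b) / (b - a)) _ x :=
    ((((hasDerivAt_id' x).const_mul 2).sub_const a).sub_const b).div_const (b - a)
  have d₃ : HasDerivAt (fun t => ((a + b) * t - 2 * a * b) / (t * (b - a))) _ x :=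
    (((hasDerivAt_id' x).const_mul (a + b)).sub_const (2 * a * b)).div
      ((hasDerivAt_id' x).mul_const (b - a)) (mul_pos hx hd).ne'
  generalize Real.sqrt (a * b) = g at *
  have e₂ := d₂.arcsin_of_sq_add_sq (w := 2 * Real.sqrt ((x - a) * (b - x)) / (b - a))
    (by positivity) (by
      rw [div_pow, div_pow, mul_pow, hS2]
      field_simp
      ring)
  have e₃ := d₃.arcsin_of_sq_add_sq (w := 2 * g * Real.sqrt ((x - a) * (b - x)) / (x * (b - a)))
    (by positivity) (by
      rw [div_pow, div_pow, mul_pow, mul_pow, mul_pow, hS2, hg2]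
      field_simp
      ring)
  refine ((d₁.add (e₂.const_mul ((a + b) / 2))).sub (e₃.const_mul g)).congr_deriv ?_
  simp only [Pi.mul_apply]
  generalize Real.sqrt ((x - a) * (b - x)) = S at *
  field_simp
  rw [hS2]
  ring

/-- `∫_a^b √((t−a)(b−t))/t dt = (π/2)(√b − √a)²` for `0 < a < b`. -/
theorem integral_sqrt_div (a b : ℝ) (ha : 0 < a) (hab : a < b) :
    ∫ t in Set.Ioo a b, Real.sqrt ((t - a) * (b - t)) / t =
      (Real.pi / 2) * (Real.sqrt b - Real.sqrt a) ^ 2 := by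
  have hb : 0 < b := ha.trans hab
  have hd : b - a ≠ 0 := (sub_pos.2 hab).ne'
  have hne : ∀ t ∈ Set.Icc a b, t ≠ 0 := fun t ht => (ha.trans_le ht.1).ne'
  rw [← MeasureTheory.integral_Ioc_eq_integral_Ioo, ← intervalIntegral.integral_of_le hab.le,
    intervalIntegral.integral_eq_sub_of_hasDerivAt_of_le hab.le ?_
      (fun x hx => hasDerivAt_sqrt_div_antideriv ha hx.1 hx.2) ?_]
  · have h₁ : (2 * b - a - b) / (b - a) = 1 := by
      rw [div_eq_one_iff_eq hd]
      ring
    have h₂ : (2 * a - a - b) / (b - a) = -1 := by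
      rw [div_eq_iff hd]
      ring
    have h₃ : ((a + b) * b - 2 * a * b) / (b * (b - a)) = 1 := by
      rw [div_eq_one_iff_eq (mul_ne_zero hb.ne' hd)]
      ring
    have h₄ : ((a + b) * a - 2 * a * b) / (a * (b - a)) = -1 := by
      rw [div_eq_iff (mul_ne_zero ha.ne' hd)]
      ring
    simp only [h₁, h₂, h₃, h₄, sub_self, mul_zero, zero_mul, Real.sqrt_zero, Real.arcsin_one,
      Real.arcsin_neg_one, Real.sqrt_mul ha.le]
    linear_combination (-Real.pi / 2) * (Real.sq_sqrt ha.le) - (Real.pi / 2) * Real.sq_sqrt hb.le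
  · have hquot : ContinuousOn (fun t => ((a + b) * t - 2 * a * b) / (t * (b - a)))
        (Set.Icc a b) :=
      ContinuousOn.div (by fun_prop) (by fun_prop) fun t ht => mul_ne_zero (hne t ht) hd
    exact ContinuousOn.sub (by fun_prop)
      (continuousOn_const.mul (Real.continuous_arcsin.comp_continuousOn hquot))
  · refine ContinuousOn.intervalIntegrable_of_Icc hab.le ?_
    exact ContinuousOn.div (by fun_prop) continuousOn_id hne
end
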